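/- Fix an odd integer γ ≥ 3 and set t = (γ+1)²/2. Let S ⊂ ℝ² consist of the red points (0,2i) for i ∈ {1,…,γ} together with r = (−t, γ+1), and the blue points (1,2i+1) for i ∈ {1,…,γ−1} together with b = (2t, γ+1). Then every subset T ⊆ S that is NN-consistent with S contains all the points (0,2i), i ∈ {1,…,γ}, and all the points (1,2i+1), i ∈ {1,…,γ−1}; consequently |T| ≥ 2γ − 1 = |S| − 2. -/

import Mathlib

noncomputable section
open Classical

/-- The Euclidean plane. -/
abbrev Pt := EuclideanSpace ℝ (Fin 2)

/-- The point `(a, b)` of the Euclidean plane. -/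
def pt (a b : ℝ) : Pt := (WithLp.equiv 2 (Fin 2 → ℝ)).symm ![a, b]

/-- `t = (γ+1)²/2`. -/
def tval (γ : ℕ) : ℝ := ((γ : ℝ) + 1) ^ 2 / 2

/-- The red points: `(0, 2i)` for `i ∈ {1,…,γ}` together with `r = (-t, γ+1)`. -/
def RedPts (γ : ℕ) : Finset Pt :=
  ((Finset.Icc 1 γ).image fun i => pt 0 (2 * (i : ℝ))) ∪
    {pt (-(tval γ)) ((γ : ℝ) + 1)}

/-- The blue points: `(1, 2i+1)` for `i ∈ {1,…,γ-1}` together with `b = (2t, γ+1)`. -/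
def BluePts (γ : ℕ) : Finset Pt :=
  ((Finset.Icc 1 (γ - 1)).image fun i => pt 1 (2 * (i : ℝ) + 1)) ∪
    {pt (2 * tval γ) ((γ : ℝ) + 1)}

/-- Labels: `true` for red, `false` for blue. -/
def lab (γ : ℕ) : Pt → Bool := fun x => if x ∈ RedPts γ then true else false

/-- `T` is NN-consistent with `S` (labels given by `l`). -/
def NNConsistent (l : Pt → Bool) (S T : Finset Pt) : Prop :=
  ∀ p ∈ S, ∃ q ∈ T, l q = l p ∧ ∀ q' ∈ T, l q' ≠ l p → dist p q ≤ dist p q'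

theorem pt_inj {a b c d : ℝ} : pt a b = pt c d ↔ a = c ∧ b = d := by
  simp [pt]

theorem dist_pt_le_iff {a b c d e f : ℝ} :
    dist (pt a b) (pt c d) ≤ dist (pt a b) (pt e f) ↔
      (a - c) ^ 2 + (b - d) ^ 2 ≤ (a - e) ^ 2 + (b - f) ^ 2 := by
  rw [EuclideanSpace.dist_eq, EuclideanSpace.dist_eq, Real.sqrt_le_sqrt_iff (by positivity)]
  simp [pt, Fin.sum_univ_two, Real.dist_eq, sq_abs]

theorem mem_redPts {γ : ℕ} {p : Pt} :
    p ∈ RedPts γ ↔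
      (∃ i : ℕ, 1 ≤ i ∧ i ≤ γ ∧ p = pt 0 (2 * (i : ℝ))) ∨ p = pt (-(tval γ)) ((γ : ℝ) + 1) := by
  simp only [RedPts, Finset.mem_union, Finset.mem_image, Finset.mem_Icc, Finset.mem_singleton,
    Finset.bind_def, Finset.pure_def, Finset.mem_sup]
  refine or_congr_left ⟨?_, ?_⟩
  · rintro ⟨_, ⟨i, ⟨h1, h2⟩, rfl⟩, rfl⟩
    exact ⟨i, h1, h2, rfl⟩
  · rintro ⟨i, h1, h2, rfl⟩
    exact ⟨_, ⟨i, ⟨h1, h2⟩, rfl⟩, rfl⟩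

theorem mem_bluePts {γ : ℕ} {p : Pt} :
    p ∈ BluePts γ ↔
      (∃ i : ℕ, 1 ≤ i ∧ i + 1 ≤ γ ∧ p = pt 1 (2 * (i : ℝ) + 1)) ∨
        p = pt (2 * tval γ) ((γ : ℝ) + 1) := by
  simp only [BluePts, Finset.mem_union, Finset.mem_image, Finset.mem_Icc, Finset.mem_singleton,
    Finset.bind_def, Finset.pure_def, Finset.mem_sup]
  refine or_congr_left ⟨?_, ?_⟩
  · rintro ⟨_, ⟨i, ⟨h1, h2⟩, rfl⟩, rfl⟩
    exact ⟨i, h1, by omega, rfl⟩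
  · rintro ⟨i, h1, h2, rfl⟩
    exact ⟨_, ⟨i, ⟨h1, by omega⟩, rfl⟩, rfl⟩

theorem tval_lower_bound {γ : ℕ} (hγ : 3 ≤ γ) : 2 * ((γ : ℝ) + 1) ≤ tval γ := by
  have h : (3 : ℝ) ≤ γ := by exact_mod_cast hγ
  unfold tval
  nlinarith

theorem tval_ge_eight {γ : ℕ} (hγ : 3 ≤ γ) : 8 ≤ tval γ := by
  have h : (3 : ℝ) ≤ γ := by exact_mod_cast hγ
  linarith [tval_lower_bound hγ]

theorem disjoint_redPts_bluePts {γ : ℕ} (hγ : 3 ≤ γ) : Disjoint (RedPts γ) (BluePts γ) := by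
  have ht := tval_ge_eight hγ
  rw [Finset.disjoint_left]
  intro p hp hp'
  rcases mem_redPts.1 hp with ⟨i, -, -, rfl⟩ | rfl <;>
  rcases mem_bluePts.1 hp' with ⟨j, -, -, h⟩ | h <;>
  · have := (pt_inj.1 h).1
    linarith

section Consistent

variable {γ : ℕ} {T : Finset Pt}

/-- A red point has a red point of `T` that is at least as near as every blue point of `T`. -/
theorem exists_red_of_consistent (hγ : 3 ≤ γ)
    (hcons : NNConsistent (lab γ) (RedPts γ ∪ BluePts γ) T) {p : Pt} (hp : p ∈ RedPts γ) :
    ∃ q ∈ T, q ∈ RedPts γ ∧ ∀ q' ∈ T, q' ∈ BluePts γ → dist p q ≤ dist p q' := by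
  obtain ⟨q, hq, hl, h⟩ := hcons p (Finset.mem_union_left _ hp)
  refine ⟨q, hq, by_contra fun hn => by simp [lab, hp, hn] at hl, fun q' hq' hb => h q' hq' ?_⟩
  simp [lab, hp, Finset.disjoint_right.1 (disjoint_redPts_bluePts hγ) hb]

/-- A blue point has a blue point of `T` that is at least as near as every red point of `T`. -/
theorem exists_blue_of_consistent (hγ : 3 ≤ γ) (hT : T ⊆ RedPts γ ∪ BluePts γ)
    (hcons : NNConsistent (lab γ) (RedPts γ ∪ BluePts γ) T) {p : Pt} (hp : p ∈ BluePts γ) :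
    ∃ q ∈ T, q ∈ BluePts γ ∧ ∀ q' ∈ T, q' ∈ RedPts γ → dist p q ≤ dist p q' := by
  have hpr := Finset.disjoint_right.1 (disjoint_redPts_bluePts hγ) hp
  obtain ⟨q, hq, hl, h⟩ := hcons p (Finset.mem_union_right _ hp)
  have hqr : q ∉ RedPts γ := fun hn => by simp [lab, hpr, hn] at hl
  refine ⟨q, hq, (Finset.mem_union.1 (hT hq)).resolve_left hqr, fun q' hq' hr => h q' hq' ?_⟩
  simp [lab, hpr, hr]

theorem four_le_sq_sub {i k : ℕ} (h : i ≠ k) : (4 : ℝ) ≤ (2 * (i : ℝ) - 2 * (k : ℝ)) ^ 2 := by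
  rcases lt_or_gt_of_ne h with h | h
  · have : (i : ℝ) + 1 ≤ k := by exact_mod_cast h
    nlinarith
  · have : (k : ℝ) + 1 ≤ i := by exact_mod_cast h
    nlinarith

/-- A blue point at height difference one forces its red neighbour into `T`. -/
theorem red_mem_of_blue_mem (hγ : 3 ≤ γ)
    (hcons : NNConsistent (lab γ) (RedPts γ ∪ BluePts γ) T) {i j : ℕ}
    (hi : 1 ≤ i) (hi' : i ≤ γ) (hj : 1 ≤ j) (hj' : j + 1 ≤ γ) (hij : i = j ∨ i = j + 1)
    (h : pt 1 (2 * (j : ℝ) + 1) ∈ T) : pt 0 (2 * (i : ℝ)) ∈ T := by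
  have ht := tval_ge_eight hγ
  obtain ⟨q, hq, hqr, hd⟩ :=
    exists_red_of_consistent hγ hcons (mem_redPts.2 (Or.inl ⟨i, hi, hi', rfl⟩))
  have hd := hd _ h (mem_bluePts.2 (Or.inl ⟨j, hj, hj', rfl⟩))
  have h2 : (2 * (i : ℝ) - (2 * (j : ℝ) + 1)) ^ 2 = 1 := by
    rcases hij with rfl | rfl <;> push_cast <;> ring
  rcases mem_redPts.1 hqr with ⟨k, -, -, rfl⟩ | rfl
  · rw [dist_pt_le_iff, h2] at hd
    by_cases hik : i = k
    · rwa [hik]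
    · linarith [four_le_sq_sub hik]
  · rw [dist_pt_le_iff, h2] at hd
    nlinarith [sq_nonneg (2 * (i : ℝ) - ((γ : ℝ) + 1))]

/-- A red point at height difference one forces its blue neighbour into `T`. -/
theorem blue_mem_of_red_mem (hγ : 3 ≤ γ) (hT : T ⊆ RedPts γ ∪ BluePts γ)
    (hcons : NNConsistent (lab γ) (RedPts γ ∪ BluePts γ) T) {i j : ℕ}
    (hi : 1 ≤ i) (hi' : i ≤ γ) (hj : 1 ≤ j) (hj' : j + 1 ≤ γ) (hij : i = j ∨ i = j + 1)
    (h : pt 0 (2 * (i : ℝ)) ∈ T) : pt 1 (2 * (j : ℝ) + 1) ∈ T := by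
  have ht := tval_ge_eight hγ
  obtain ⟨q, hq, hqb, hd⟩ :=
    exists_blue_of_consistent hγ hT hcons (mem_bluePts.2 (Or.inl ⟨j, hj, hj', rfl⟩))
  have hd := hd _ h (mem_redPts.2 (Or.inl ⟨i, hi, hi', rfl⟩))
  have h2 : (2 * (j : ℝ) + 1 - 2 * (i : ℝ)) ^ 2 = 1 := by
    rcases hij with rfl | rfl <;> push_cast <;> ring
  rcases mem_bluePts.1 hqb with ⟨k, -, -, rfl⟩ | rfl
  · rw [dist_pt_le_iff, h2] at hd
    by_cases hjk : j = k
    · rwa [hjk]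
    · linarith [four_le_sq_sub hjk]
  · rw [dist_pt_le_iff, h2] at hd
    nlinarith [sq_nonneg (2 * (j : ℝ) + 1 - ((γ : ℝ) + 1))]

/-- Some blue point on the line `x = 1` belongs to `T`. -/
theorem exists_near_blue_mem (hγ : 3 ≤ γ) (hT : T ⊆ RedPts γ ∪ BluePts γ)
    (hcons : NNConsistent (lab γ) (RedPts γ ∪ BluePts γ) T) :
    ∃ j : ℕ, 1 ≤ j ∧ j + 1 ≤ γ ∧ pt 1 (2 * (j : ℝ) + 1) ∈ T := by
  have ht := tval_lower_bound hγ
  have hγ' : (3 : ℝ) ≤ γ := by exact_mod_cast hγ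
  obtain ⟨r, hr, hrr, -⟩ := exists_red_of_consistent hγ hcons (mem_redPts.2 (Or.inr rfl))
  obtain ⟨q, hq, hqb, hd⟩ := exists_blue_of_consistent hγ hT hcons
    (mem_bluePts.2 (Or.inl ⟨1, le_rfl, by omega, rfl⟩))
  rcases mem_bluePts.1 hqb with ⟨k, hk, hk', rfl⟩ | rfl
  · exact ⟨k, hk, hk', hq⟩
  exfalso
  have hd := hd r hr hrr
  rcases mem_redPts.1 hrr with ⟨i, hi, hi', rfl⟩ | rfl
  · rw [dist_pt_le_iff] at hd
    have hi₁ : (1 : ℝ) ≤ i := by exact_mod_cast hi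
    have hi₂ : (i : ℝ) ≤ γ := by exact_mod_cast hi'
    have h1 : (2 * ((1 : ℕ) : ℝ) + 1 - 2 * (i : ℝ)) ^ 2 ≤ (2 * (γ : ℝ)) ^ 2 := by
      push_cast
      apply sq_le_sq' <;> linarith
    have h2 : (4 * (γ : ℝ) + 3) ^ 2 ≤ (1 - 2 * tval γ) ^ 2 := by
      rw [sub_sq_comm]
      exact pow_le_pow_left₀ (by linarith) (by linarith) 2
    nlinarith [sq_nonneg (2 * ((1 : ℕ) : ℝ) + 1 - ((γ : ℝ) + 1))]
  · rw [dist_pt_le_iff] at hd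
    nlinarith

/-- Some red point on the line `x = 0` belongs to `T`. -/
theorem exists_near_red_mem (hγ : 3 ≤ γ) (hT : T ⊆ RedPts γ ∪ BluePts γ)
    (hcons : NNConsistent (lab γ) (RedPts γ ∪ BluePts γ) T) :
    ∃ i : ℕ, 1 ≤ i ∧ i ≤ γ ∧ pt 0 (2 * (i : ℝ)) ∈ T := by
  obtain ⟨j, hj, hj', h⟩ := exists_near_blue_mem hγ hT hcons
  exact ⟨j, hj, by omega, red_mem_of_blue_mem hγ hcons hj (by omega) hj hj' (Or.inl rfl) h⟩

theorem red_mem_of_consistent (hγ : 3 ≤ γ) (hT : T ⊆ RedPts γ ∪ BluePts γ)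
    (hcons : NNConsistent (lab γ) (RedPts γ ∪ BluePts γ) T) {i : ℕ}
    (hi : 1 ≤ i) (hi' : i ≤ γ) : pt 0 (2 * (i : ℝ)) ∈ T := by
  have step : ∀ k : ℕ, 1 ≤ k → k + 1 ≤ γ →
      (pt 0 (2 * ((k + 1 : ℕ) : ℝ)) ∈ T ↔ pt 0 (2 * (k : ℝ)) ∈ T) := fun k hk hk' =>
    ⟨fun h => red_mem_of_blue_mem hγ hcons hk (by omega) hk hk' (Or.inl rfl)
      (blue_mem_of_red_mem hγ hT hcons (by omega) hk' hk hk' (Or.inr rfl) h),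
    fun h => red_mem_of_blue_mem hγ hcons (by omega) hk' hk hk' (Or.inr rfl)
      (blue_mem_of_red_mem hγ hT hcons hk (by omega) hk hk' (Or.inl rfl) h)⟩
  have iff_first : ∀ k : ℕ, 1 ≤ k → k ≤ γ →
      (pt 0 (2 * (k : ℝ)) ∈ T ↔ pt 0 (2 * ((1 : ℕ) : ℝ)) ∈ T) := by
    intro k hk
    induction k, hk using Nat.le_induction with
    | base => exact fun _ => Iff.rfl
    | succ k hk ih => exact fun hk' => (step k hk hk').trans (ih (by omega))
  obtain ⟨k, hk, hk', h⟩ := exists_near_red_mem hγ hT hcons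
  exact (iff_first i hi hi').2 ((iff_first k hk hk').1 h)

theorem blue_mem_of_consistent (hγ : 3 ≤ γ) (hT : T ⊆ RedPts γ ∪ BluePts γ)
    (hcons : NNConsistent (lab γ) (RedPts γ ∪ BluePts γ) T) {j : ℕ}
    (hj : 1 ≤ j) (hj' : j + 1 ≤ γ) : pt 1 (2 * (j : ℝ) + 1) ∈ T :=
  blue_mem_of_red_mem hγ hT hcons hj (by omega) hj hj' (Or.inl rfl)
    (red_mem_of_consistent hγ hT hcons hj (by omega))

end Consistent

theorem le_card_of_zigzag_mem {γ : ℕ} {T : Finset Pt}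
    (hR : ∀ i ∈ Finset.Icc 1 γ, pt 0 (2 * (i : ℝ)) ∈ T)
    (hB : ∀ i ∈ Finset.Icc 1 (γ - 1), pt 1 (2 * (i : ℝ) + 1) ∈ T) : 2 * γ - 1 ≤ T.card := by
  have hsub : ((Finset.Icc 1 γ).image fun i : ℕ => pt 0 (2 * (i : ℝ))) ∪
      ((Finset.Icc 1 (γ - 1)).image fun i : ℕ => pt 1 (2 * (i : ℝ) + 1)) ⊆ T :=
    Finset.union_subset (Finset.image_subset_iff.2 hR) (Finset.image_subset_iff.2 hB)
  have hdisj : Disjoint ((Finset.Icc 1 γ).image fun i : ℕ => pt 0 (2 * (i : ℝ)))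
      ((Finset.Icc 1 (γ - 1)).image fun i : ℕ => pt 1 (2 * (i : ℝ) + 1)) := by
    rw [Finset.disjoint_left]
    intro p hp hp'
    obtain ⟨i, -, rfl⟩ := Finset.mem_image.1 hp
    obtain ⟨j, -, h⟩ := Finset.mem_image.1 hp'
    exact one_ne_zero (pt_inj.1 h).1
  have hcard := Finset.card_le_card hsub
  rw [Finset.card_union_of_disjoint hdisj, Finset.card_image_of_injective,
    Finset.card_image_of_injective, Nat.card_Icc, Nat.card_Icc] at hcard
  · omega
  · intro i j h
    simpa using (pt_inj.1 h).2
  · intro i j h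
    simpa using (pt_inj.1 h).2

/-- For odd `γ ≥ 3`, every NN-consistent subset of the dataset of Lemma 1 (second
construction) contains all points `(0,2i)` and all points `(1,2i+1)`; consequently it
has at least `2γ - 1` points. -/
theorem stmt9 (γ : ℕ) (hodd : Odd γ) (hγ : 3 ≤ γ)
    (T : Finset Pt) (hT : T ⊆ RedPts γ ∪ BluePts γ)
    (hcons : NNConsistent (lab γ) (RedPts γ ∪ BluePts γ) T) :
    (∀ i ∈ Finset.Icc 1 γ, pt 0 (2 * (i : ℝ)) ∈ T) ∧
    (∀ i ∈ Finset.Icc 1 (γ - 1), pt 1 (2 * (i : ℝ) + 1) ∈ T) ∧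
    2 * γ - 1 ≤ T.card := by
  have hR : ∀ i ∈ Finset.Icc 1 γ, pt 0 (2 * (i : ℝ)) ∈ T := fun i hi =>
    red_mem_of_consistent hγ hT hcons (Finset.mem_Icc.1 hi).1 (Finset.mem_Icc.1 hi).2
  have hB : ∀ i ∈ Finset.Icc 1 (γ - 1), pt 1 (2 * (i : ℝ) + 1) ∈ T := fun i hi => by
    rw [Finset.mem_Icc] at hi
    exact blue_mem_of_consistent hγ hT hcons hi.1 (by omega)
  exact ⟨hR, hB, le_card_of_zigzag_mem hR hB⟩
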